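/- arXiv:math/0607148 — 7 statements merged into one kernel-verified Lean document; each statement's English description precedes it below -/
import Mathlib

section
/- Let n ≥ 1, k ∈ ℕ, and let F, A₁, …, A_{2k+1} be n×n complex matrices such that F·F = 1 and F·Aᵢ = −Aᵢ·F for every i = 1, …, 2k+1. Then tr(A₁·A₂·⋯·A_{2k+1}) = 0. -/
/-- Moving an element past a product of elements anticommuting with it
contributes one sign per factor. -/
theorem mul_list_prod_of_anticommute {R : Type*} [Ring R] {a : R} (l : List R)
    (h : ∀ x ∈ l, a * x = -(x * a)) :
    a * l.prod = (-1) ^ l.length * (l.prod * a) := by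
  induction l with
  | nil => simp
  | cons x l ih =>
    rw [List.forall_mem_cons] at h
    rw [List.prod_cons, ← mul_assoc, h.1, neg_mul, mul_assoc, ih h.2, List.length_cons, pow_succ,
      ← mul_assoc x, ((Commute.neg_one_right x).pow_right _).eq]
    simp only [mul_neg, mul_one, neg_mul, mul_assoc]

/-- A matrix anticommuting with an involution has zero trace. -/
theorem Matrix.trace_eq_zero_of_anticommute {m R : Type*} [Fintype m] [DecidableEq m]
    [CommRing R] [IsAddTorsionFree R] {F P : Matrix m m R}
    (hF : F * F = 1) (h : F * P = -(P * F)) : P.trace = 0 := by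
  rw [← self_eq_neg]
  calc P.trace = (F * P * F).trace := by rw [Matrix.trace_mul_cycle, hF, one_mul]
    _ = -P.trace := by rw [h, neg_mul, mul_assoc, hF, mul_one, Matrix.trace_neg]

/-- Let `n ≥ 1`, `k ∈ ℕ`, and let `F, A₁, …, A_{2k+1}` be `n × n` complex matrices such that
`F * F = 1` and `F * Aᵢ = -(Aᵢ * F)` for every `i`.  Then the trace of the ordered product
`A₁ * A₂ * ⋯ * A_{2k+1}` vanishes. -/
theorem trace_odd_product_anticommuting_eq_zero
    (n k : ℕ) (hn : 1 ≤ n)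
    (F : Matrix (Fin n) (Fin n) ℂ)
    (A : Fin (2 * k + 1) → Matrix (Fin n) (Fin n) ℂ)
    (hF : F * F = 1)
    (hA : ∀ i, F * A i = -(A i * F)) :
    Matrix.trace (List.ofFn A).prod = 0 := by
  refine Matrix.trace_eq_zero_of_anticommute hF ?_
  rw [mul_list_prod_of_anticommute _ (List.forall_mem_ofFn_iff.2 hA), List.length_ofFn,
    (odd_two_mul_add_one k).neg_one_pow, neg_one_mul]
end

section
/- Let E be a real normed vector space, n ≥ 1, and let F : E → M_n(ℂ) be differentiable with F(x)·F(x) = 1 for every x ∈ E. Then for every x ∈ E, every k ∈ ℕ and all vectors v₁, …, v_{2k+1} ∈ E, one has tr( (D_{v₁}F)(x) · (D_{v₂}F)(x) · ⋯ · (D_{v_{2k+1}}F)(x) ) = 0. (Consequently each even form ω_{2j} = tr(F (dF)^{2j}) is closed, since dω_{2j} = tr((dF)^{2j+1}).) -/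
/-- The product of a list of elements anticommuting with `a` semicommutes with `a` up to the sign
`(-1) ^ l.length`. -/
theorem List.mul_prod_of_forall_mul_eq_neg {R : Type*} [Ring R] {a : R} {l : List R}
    (h : ∀ b ∈ l, a * b = -(b * a)) : a * l.prod = (-1) ^ l.length * (l.prod * a) := by
  induction l with
  | nil => simp
  | cons b l ih =>
    simp only [List.forall_mem_cons] at h
    have hc : Commute ((-1 : R) ^ l.length) b := (Commute.neg_one_left b).pow_left _
    rw [List.prod_cons, ← mul_assoc, h.1, neg_mul, mul_assoc, ih h.2, ← mul_assoc b, ← hc.eq,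
      List.length_cons, pow_succ]
    noncomm_ring

/-- If `A` is an involution, then a product of an odd number of matrices anticommuting with `A`
has trace zero. -/
theorem Matrix.trace_list_prod_eq_zero_of_anticommute {m R : Type*} [Fintype m] [DecidableEq m]
    [CommRing R] [IsAddTorsionFree R] {A : Matrix m m R} (hA : A * A = 1) {l : List (Matrix m m R)}
    (hl : Odd l.length) (h : ∀ B ∈ l, A * B = -(B * A)) : l.prod.trace = 0 := by
  have hP : A * l.prod = -(l.prod * A) := by
    rw [List.mul_prod_of_forall_mul_eq_neg h, hl.neg_one_pow, neg_one_mul]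
  rw [← self_eq_neg]
  calc l.prod.trace = (A * l.prod * A).trace := by
        rw [Matrix.trace_mul_comm, ← mul_assoc, hA, one_mul]
    _ = -l.prod.trace := by
        rw [hP, neg_mul, mul_assoc, hA, mul_one, Matrix.trace_neg]

attribute [local instance] Matrix.normedAddCommGroup Matrix.normedSpace

/-- The directional derivatives of a matrix-valued map with constant square anticommute with it. -/
theorem Matrix.mul_fderiv_eq_neg_of_mul_self_eq {E : Type*} [NormedAddCommGroup E]
    [NormedSpace ℝ E] {m : Type*} [Fintype m] {F : E → Matrix m m ℂ}
    {C : Matrix m m ℂ} {x : E} (hd : DifferentiableAt ℝ F x) (hF : ∀ y, F y * F y = C) (v : E) :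
    F x * fderiv ℝ F x v = -(fderiv ℝ F x v * F x) := by
  let B : Matrix m m ℂ →L[ℝ] Matrix m m ℂ →L[ℝ] Matrix m m ℂ :=
    (LinearMap.mul ℝ (Matrix m m ℂ)).toContinuousBilinearMap
  have hB := B.hasFDerivAt_of_bilinear hd.hasFDerivAt hd.hasFDerivAt
  have hC : HasFDerivAt (fun y => B (F y) (F y)) (0 : E →L[ℝ] Matrix m m ℂ) x :=
    (hasFDerivAt_const C x).congr_of_eventuallyEq (.of_forall hF)
  have key := DFunLike.congr_fun (hB.unique hC) v
  exact eq_neg_of_add_eq_zero_left key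

/-- Let `E` be a real normed vector space, `n ≥ 1`, and let `F : E → Mₙ(ℂ)` be differentiable
with `F x * F x = 1` for every `x`.  Then for every `x`, every `k` and all vectors
`v₁, …, v_{2k+1}`, the trace of the ordered product of the directional derivatives
`(D_{v₁}F)(x) ⋯ (D_{v_{2k+1}}F)(x)` vanishes.  Consequently each even form
`ω_{2j} = tr(F (dF)^{2j})` is closed, since `dω_{2j} = tr((dF)^{2j+1})`. -/
theorem trace_odd_product_fderiv_eq_zero
    {E : Type*} [NormedAddCommGroup E] [NormedSpace ℝ E]
    (n : ℕ) (hn : 1 ≤ n)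
    (F : E → Matrix (Fin n) (Fin n) ℂ)
    (hFdiff : Differentiable ℝ F)
    (hF : ∀ x, F x * F x = 1)
    (x : E) (k : ℕ) (v : Fin (2 * k + 1) → E) :
    Matrix.trace (List.ofFn fun i => fderiv ℝ F x (v i)).prod = 0 := by
  refine Matrix.trace_list_prod_eq_zero_of_anticommute (hF x) (by simp) ?_
  simp only [List.forall_mem_ofFn_iff]
  exact fun i => Matrix.mul_fderiv_eq_neg_of_mul_self_eq (hFdiff x) hF (v i)
end

section
/- Let P, X, Y be n×n complex matrices with P·P = P. Then tr(X·[P,Y]) − tr(Y·[P,X]) + tr([X,Y]·P) = tr(P·[[P,X],[P,Y]]), and both sides are equal to −tr([X,Y]·P). -/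
/-- For an idempotent `e`, the element `e [[e, x], [e, y]]` is the commutator of the compressions
`e x e` and `e y e` minus the compression of `[x, y]`. -/
theorem IsIdempotentElem.mul_commutator_commutator {R : Type*} [Ring R] {e : R}
    (he : IsIdempotentElem e) (x y : R) :
    e * ((e * x - x * e) * (e * y - y * e) - (e * y - y * e) * (e * x - x * e)) =
      (e * x * e) * (e * y * e) - (e * y * e) * (e * x * e) - e * (x * y - y * x) * e := by
  have h (a : R) : e * (e * a) = e * a := by rw [← mul_assoc, he.eq]
  simp only [mul_sub, sub_mul, mul_assoc, h]
  abel

/-- The trace of the double commutator of an idempotent matrix. -/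
theorem Matrix.trace_mul_commutator_commutator {m R : Type*} [Fintype m] [CommRing R]
    {P : Matrix m m R} (hP : IsIdempotentElem P) (X Y : Matrix m m R) :
    Matrix.trace (P * ((P * X - X * P) * (P * Y - Y * P) - (P * Y - Y * P) * (P * X - X * P))) =
      -Matrix.trace ((X * Y - Y * X) * P) := by
  classical
  rw [hP.mul_commutator_commutator, Matrix.trace_sub, Matrix.trace_sub,
    Matrix.trace_mul_comm (P * X * P), sub_self, zero_sub, Matrix.mul_assoc P,
    Matrix.trace_mul_comm P, Matrix.mul_assoc, hP.eq]

/-- The invariance of the trace form: `tr (X [P, Y]) = -tr ([X, Y] P)`. -/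
theorem Matrix.trace_mul_commutator {m R : Type*} [Fintype m] [CommRing R]
    (P X Y : Matrix m m R) :
    Matrix.trace (X * (P * Y - Y * P)) = -Matrix.trace ((X * Y - Y * X) * P) := by
  rw [Matrix.mul_sub, Matrix.sub_mul, Matrix.trace_sub, Matrix.trace_sub, ← Matrix.mul_assoc,
    Matrix.trace_mul_comm (X * P), ← Matrix.mul_assoc, ← Matrix.mul_assoc, neg_sub]


/-- Let `P, X, Y` be `n × n` complex matrices with `P * P = P`.  Then
`tr(X·[P,Y]) − tr(Y·[P,X]) + tr([X,Y]·P) = tr(P·[[P,X],[P,Y]])`, and both sides equal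
`−tr([X,Y]·P)`.  Here `[A,B] = A*B − B*A`. -/
theorem trace_gauge_orbit_cocycle
    (n : ℕ) (P X Y : Matrix (Fin n) (Fin n) ℂ) (hP : P * P = P) :
    (Matrix.trace (X * (P * Y - Y * P)) - Matrix.trace (Y * (P * X - X * P))
        + Matrix.trace ((X * Y - Y * X) * P)
      = Matrix.trace (P * ((P * X - X * P) * (P * Y - Y * P)
          - (P * Y - Y * P) * (P * X - X * P)))) ∧
    Matrix.trace (P * ((P * X - X * P) * (P * Y - Y * P)
        - (P * Y - Y * P) * (P * X - X * P)))
      = -Matrix.trace ((X * Y - Y * X) * P) := by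
  have h := Matrix.trace_mul_commutator_commutator (P := P) hP X Y
  refine ⟨?_, h⟩
  rw [h, Matrix.trace_mul_commutator P X Y, Matrix.trace_mul_commutator P Y X,
    ← neg_sub (X * Y), Matrix.neg_mul, Matrix.trace_neg]
  ring
end

section
/- Let E be a real normed vector space, n ≥ 1, and let P, Q : E → M_n(ℂ) be differentiable maps with P(x)² = P(x), Q(x)² = Q(x) and P(x)·Q(x) = Q(x)·P(x) = 0 for every x ∈ E. Set R := P + Q. Then R(x)² = R(x) for all x, and for every x ∈ E and all v, w ∈ E: tr( R·(D_vR·D_wR − D_wR·D_vR) ) = tr( P·(D_vP·D_wP − D_wP·D_vP) ) + tr( Q·(D_vQ·D_wQ − D_wQ·D_vQ) ) (all matrices evaluated at x). -/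
attribute [local instance] Matrix.normedAddCommGroup Matrix.normedSpace

/-- Product rule for directional derivatives of matrix-valued maps. -/
lemma fderiv_matrix_mul_apply {E : Type*} [NormedAddCommGroup E] [NormedSpace ℝ E] {n : ℕ}
    {P Q : E → Matrix (Fin n) (Fin n) ℂ} {x : E}
    (hP : DifferentiableAt ℝ P x) (hQ : DifferentiableAt ℝ Q x) (v : E) :
    fderiv ℝ (fun y => P y * Q y) x v = P x * fderiv ℝ Q x v + fderiv ℝ P x v * Q x := by
  let B : Matrix (Fin n) (Fin n) ℂ →L[ℝ] Matrix (Fin n) (Fin n) ℂ →L[ℝ] Matrix (Fin n) (Fin n) ℂ :=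
    (LinearMap.mul ℝ (Matrix (Fin n) (Fin n) ℂ)).toContinuousBilinearMap
  have h := B.fderiv_of_bilinear hP hQ
  exact DFunLike.congr_fun h v

/-- The algebraic core: if `a, c` and `b, d` are two tangent vectors at `(p, q)` to the set of pairs
`(p, q)` of elements with `p` idempotent and `p * q = q * p = 0`, the trace of the commutator form
at `p + q` is the sum of those at `p` and `q`. -/
lemma Matrix.trace_add_mul_commutator_of_orthogonal {ι S : Type*} [Fintype ι] [CommRing S]
    {p q a b c d : Matrix ι ι S} (hp : p * p = p)
    (hv : p * c = -(a * q)) (hw : p * d = -(b * q))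
    (hv' : c * p = -(q * a)) (hw' : d * p = -(q * b)) (hq : q * q = q) :
    trace ((p + q) * ((a + c) * (b + d) - (b + d) * (a + c)))
      = trace (p * (a * b - b * a)) + trace (q * (c * d - d * c)) := by
  have cyc (x y z : Matrix ι ι S) : trace (x * (y * z)) = trace (y * (z * x)) := by
    rw [trace_mul_comm, Matrix.mul_assoc]
  have pad {a d b : Matrix ι ι S} (h : d * p = -(q * b)) :
      trace (p * (a * d)) = -trace (a * (q * b)) := by
    rw [cyc, h, Matrix.mul_neg, trace_neg]
  have pcb {a c b : Matrix ι ι S} (h : p * c = -(a * q)) :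
      trace (p * (c * b)) = -trace (a * (q * b)) := by
    rw [← Matrix.mul_assoc, h, Matrix.neg_mul, trace_neg, Matrix.mul_assoc]
  have pcd {a b c d : Matrix ι ι S} (h : p * c = -(a * q)) (h' : d * p = -(q * b)) :
      trace (p * (c * d)) = trace (a * (q * b)) := by
    have e : p * (c * d) = p * (p * c * d) := by
      rw [← Matrix.mul_assoc, ← Matrix.mul_assoc, ← Matrix.mul_assoc, hp]
    rw [e, trace_mul_comm, Matrix.mul_assoc, h, h', neg_mul_neg, Matrix.mul_assoc,
      ← Matrix.mul_assoc q, hq]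
  have qab (a b : Matrix ι ι S) : trace (q * (a * b)) = trace (b * (q * a)) := (cyc b q a).symm
  have qad {a b c d : Matrix ι ι S} (h : p * d = -(b * q)) (h' : c * p = -(q * a)) :
      trace (q * (a * d)) = -trace (b * (q * a)) := by
    have e : q * a = -(c * p) := by rw [h', neg_neg]
    rw [← pcd h h', ← Matrix.mul_assoc, e, Matrix.neg_mul, trace_neg, Matrix.mul_assoc, cyc]
  have qcb {a b c d : Matrix ι ι S} (h : p * d = -(b * q)) (h' : c * p = -(q * a)) :
      trace (q * (c * b)) = -trace (b * (q * a)) := by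
    have e : b * q = -(p * d) := by rw [h, neg_neg]
    rw [← pcd h h', cyc, e, Matrix.mul_neg, trace_neg, cyc]
  simp only [Matrix.add_mul, Matrix.mul_add, Matrix.mul_sub, trace_add, trace_sub]
  rw [pad (a := a) hw', pad (a := b) hv', pcb (b := b) hv, pcb (b := a) hw, pcd hv hw',
    pcd hw hv', qab a b, qab b a, qad hw hv', qad hv hw', qcb hw hv', qcb hv hw']
  ring

/-- Let `P, Q : E → Mₙ(ℂ)` be differentiable, pointwise idempotent and mutually orthogonal
(`P·Q = Q·P = 0` pointwise), and let `R := P + Q`.  Then `R` is pointwise idempotent and the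
2-form `tr(R (dR)²)` is the sum of the corresponding 2-forms for `P` and `Q`:
`tr(R·(D_vR·D_wR − D_wR·D_vR)) = tr(P·(D_vP·D_wP − D_wP·D_vP)) + tr(Q·(D_vQ·D_wQ − D_wQ·D_vQ))`. -/
theorem trace_two_form_additive_of_orthogonal_projections
    {E : Type*} [NormedAddCommGroup E] [NormedSpace ℝ E]
    (n : ℕ) (hn : 1 ≤ n)
    (P Q R : E → Matrix (Fin n) (Fin n) ℂ)
    (hPdiff : Differentiable ℝ P) (hQdiff : Differentiable ℝ Q)
    (hP : ∀ x, P x * P x = P x) (hQ : ∀ x, Q x * Q x = Q x)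
    (hPQ : ∀ x, P x * Q x = 0) (hQP : ∀ x, Q x * P x = 0)
    (hR : ∀ x, R x = P x + Q x) :
    (∀ x, R x * R x = R x) ∧
    ∀ (x v w : E),
      Matrix.trace (R x *
          (fderiv ℝ R x v * fderiv ℝ R x w - fderiv ℝ R x w * fderiv ℝ R x v))
        = Matrix.trace (P x *
            (fderiv ℝ P x v * fderiv ℝ P x w - fderiv ℝ P x w * fderiv ℝ P x v))
          + Matrix.trace (Q x *
            (fderiv ℝ Q x v * fderiv ℝ Q x w - fderiv ℝ Q x w * fderiv ℝ Q x v)) := by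
  obtain rfl : R = fun x => P x + Q x := funext hR
  refine ⟨fun x => by simp [add_mul, mul_add, hP, hQ, hPQ, hQP], fun x v w => ?_⟩
  have key {F G : E → Matrix (Fin n) (Fin n) ℂ} (hF : Differentiable ℝ F)
      (hG : Differentiable ℝ G) (h : ∀ x, F x * G x = 0) (u : E) :
      F x * fderiv ℝ G x u = -(fderiv ℝ F x u * G x) := by
    have e := fderiv_matrix_mul_apply (hF x) (hG x) u
    simp only [h, fderiv_fun_const, Pi.zero_apply, _root_.zero_apply] at e
    exact eq_neg_of_add_eq_zero_left e.symm
  have key' (u : E) : fderiv ℝ Q x u * P x = -(Q x * fderiv ℝ P x u) :=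
    neg_eq_iff_eq_neg.mp (key hQdiff hPdiff hQP u).symm
  have e : fderiv ℝ (fun x => P x + Q x) x = fderiv ℝ P x + fderiv ℝ Q x :=
    fderiv_fun_add (hPdiff x) (hQdiff x)
  rw [e]
  exact Matrix.trace_add_mul_commutator_of_orthogonal (hP x) (key hPdiff hQdiff hPQ v)
    (key hPdiff hQdiff hPQ w) (key' v) (key' w) (hQ x)
end

section
/- Let E be a real normed vector space, n ≥ 1, and let P, P', P'' : E → M_n(ℂ) be differentiable maps which are pointwise idempotent (P² = P, P'² = P', P''² = P'') and mutually orthogonal: P·P' = P'·P = P·P'' = P''·P = P'·P'' = P''·P' = 0 at every point. Then for every x ∈ E and all v, w ∈ E, tr( P(x) · (D_vP')(x) · (D_wP'')(x) ) = 0. -/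
attribute [local instance] Matrix.normedAddCommGroup Matrix.normedSpace

/-- If the product of two differentiable matrix-valued maps vanishes identically, then the Leibniz
rule gives `F · D_vG = -(D_vF) · G`. -/
theorem mul_fderiv_eq_neg_of_mul_eq_zero
    {E : Type*} [NormedAddCommGroup E] [NormedSpace ℝ E] {n : ℕ}
    {F G : E → Matrix (Fin n) (Fin n) ℂ} {x : E}
    (hF : DifferentiableAt ℝ F x) (hG : DifferentiableAt ℝ G x)
    (h : ∀ y, F y * G y = 0) (v : E) :
    F x * fderiv ℝ G x v = -(fderiv ℝ F x v * G x) := by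
  let B := (LinearMap.mul ℝ (Matrix (Fin n) (Fin n) ℂ)).toContinuousBilinearMap
  have hzero : HasFDerivAt (fun y => F y * G y) (0 : E →L[ℝ] Matrix (Fin n) (Fin n) ℂ) x := by
    simpa only [h] using hasFDerivAt_const (0 : Matrix (Fin n) (Fin n) ℂ) x
  have key := DFunLike.congr_fun
    (hzero.unique (B.hasFDerivAt_of_bilinear hF.hasFDerivAt hG.hasFDerivAt)) v
  exact eq_neg_of_add_eq_zero_left key.symm

/-- For a triple `P, P', P'' : E → Mₙ(ℂ)` of differentiable, pointwise idempotent and mutually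
orthogonal families of projections, one has `tr(P x · (D_vP')(x) · (D_wP'')(x)) = 0` for all
`x, v, w`. -/
theorem trace_P_dP'_dP''_eq_zero
    {E : Type*} [NormedAddCommGroup E] [NormedSpace ℝ E]
    (n : ℕ) (hn : 1 ≤ n)
    (P P' P'' : E → Matrix (Fin n) (Fin n) ℂ)
    (hPdiff : Differentiable ℝ P) (hP'diff : Differentiable ℝ P')
    (hP''diff : Differentiable ℝ P'')
    (hP : ∀ x, P x * P x = P x) (hP' : ∀ x, P' x * P' x = P' x)
    (hP'' : ∀ x, P'' x * P'' x = P'' x)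
    (h12 : ∀ x, P x * P' x = 0) (h21 : ∀ x, P' x * P x = 0)
    (h13 : ∀ x, P x * P'' x = 0) (h31 : ∀ x, P'' x * P x = 0)
    (h23 : ∀ x, P' x * P'' x = 0) (h32 : ∀ x, P'' x * P' x = 0)
    (x v w : E) :
    Matrix.trace (P x * fderiv ℝ P' x v * fderiv ℝ P'' x w) = 0 := by
  have hPA : P x * fderiv ℝ P' x v * P' x = P x * fderiv ℝ P' x v := by
    rw [mul_fderiv_eq_neg_of_mul_eq_zero (hPdiff x) (hP'diff x) h12 v, neg_mul, mul_assoc, hP' x]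
  have hBP : P' x * fderiv ℝ P'' x w * P x = 0 := by
    rw [mul_fderiv_eq_neg_of_mul_eq_zero (hP'diff x) (hP''diff x) h23 w, neg_mul, mul_assoc,
      h31 x, mul_zero, neg_zero]
  calc Matrix.trace (P x * fderiv ℝ P' x v * fderiv ℝ P'' x w)
      = Matrix.trace (P x * (fderiv ℝ P' x v * P' x * fderiv ℝ P'' x w)) := by
        rw [← hPA]; simp only [mul_assoc]
    _ = Matrix.trace (P x * P x * (fderiv ℝ P' x v * P' x * fderiv ℝ P'' x w)) := by rw [hP x]
    _ = Matrix.trace (P x * (fderiv ℝ P' x v * (P' x * fderiv ℝ P'' x w * P x))) := by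
        rw [mul_assoc, Matrix.trace_mul_comm]; simp only [mul_assoc]
    _ = 0 := by rw [hBP, mul_zero, mul_zero, Matrix.trace_zero]
end

section
/- Let g : ℝ → ℂ be measurable, let a ∈ ℂ, and assume: (i) there is a function h bounded on (0,1] with g(t) = a·t^{−1/2} + h(t) for all t ∈ (0,1]; (ii) there exist C > 0 and c > 0 with ‖g(t)‖ ≤ C·e^{−c t} for all t ≥ 1. Then both of the following limits exist and lim_{ε→0⁺} √ε · g(ε) = a, while lim_{z→0⁺} z · Γ(z + 1/2)⁻¹ · mellin g (z + 1/2) = a/√π (z real, z → 0 from the right). In particular lim_{ε→0⁺} √ε·g(ε) = √π · lim_{z→0⁺} z · Γ(z+1/2)⁻¹ · mellin g (z+1/2). -/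
theorem MeasureTheory.LocallyIntegrableOn.of_measurable_of_bound {g : ℝ → ℂ} (hg : Measurable g) {s : Set ℝ}
    (hs : IsLocallyClosed s) {B : ℝ} (hB : ∀ t ∈ s, ‖g t‖ ≤ B) :
    LocallyIntegrableOn g s := by
  rw [locallyIntegrableOn_iff hs]
  intro K hKs hK
  refine .of_bound hK.measure_lt_top hg.aestronglyMeasurable B ?_
  exact (ae_restrict_mem hK.measurableSet).mono fun t ht => hB t (hKs ht)

/-- If `g` is a bounded perturbation of `a * t ^ (-b)` near `0` and decays exponentially, then its
Mellin transform has a simple pole with residue `a` at `b`. -/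
theorem tendsto_mul_mellin_add_of_exp_decay
    {g : ℝ → ℂ} (hg : Measurable g) {a : ℂ} {b : ℝ} (hb : 0 < b) {M : ℝ}
    (hbd : ∀ t ∈ Set.Ioc (0 : ℝ) 1, ‖g t - a * ((t ^ (-b) : ℝ) : ℂ)‖ ≤ M)
    {C c : ℝ} (hc : 0 < c) (hdecay : ∀ t : ℝ, 1 ≤ t → ‖g t‖ ≤ C * Real.exp (-c * t)) :
    Filter.Tendsto (fun z : ℝ => (z : ℂ) * mellin g ((z : ℂ) + b))
      (nhdsWithin (0 : ℝ) (Set.Ioi 0)) (nhds a) := by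
  set p : ℝ → ℂ := (Set.Ioc (0 : ℝ) 1).indicator fun t => (t : ℂ) ^ (-(b : ℂ)) with hp
  set k : ℝ → ℂ := fun t => g t - a * p t with hk
  have hk_meas : Measurable k := by
    exact hg.sub (measurable_const.mul (Measurable.indicator (by fun_prop) measurableSet_Ioc))
  have hk_le_one : ∀ t ∈ Set.Ioc (0 : ℝ) 1, ‖k t‖ ≤ M := by
    intro t ht
    have := hbd t ht
    rw [Complex.ofReal_cpow ht.1.le, Complex.ofReal_neg] at this
    simpa [hk, hp, Set.indicator_of_mem ht] using this
  have hk_gt_one : ∀ t : ℝ, 1 < t → ‖k t‖ ≤ C * Real.exp (-c * t) := by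
    intro t ht
    have hnot : t ∉ Set.Ioc (0 : ℝ) 1 := fun h => ht.not_ge h.2
    simpa [hk, hp, Set.indicator_of_notMem hnot] using hdecay t ht.le
  have hC : 0 ≤ C := nonneg_of_mul_nonneg_left
    ((norm_nonneg _).trans (hdecay 1 le_rfl)) (Real.exp_pos _)
  have hk_loc : MeasureTheory.LocallyIntegrableOn k (Set.Ioi 0) := by
    refine .of_measurable_of_bound hk_meas isOpen_Ioi.isLocallyClosed (B := max M C) ?_
    intro t ht
    rcases le_or_gt t 1 with h1 | h1
    · exact (hk_le_one t ⟨ht, h1⟩).trans (le_max_left _ _)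
    · refine ((hk_gt_one t h1).trans (mul_le_of_le_one_right hC ?_)).trans (le_max_right _ _)
      exact Real.exp_le_one_iff.2 (by nlinarith)
  have hk_top : k =O[Filter.atTop] fun t => Real.exp (-c * t) := by
    refine .of_bound C ((Filter.eventually_gt_atTop 1).mono fun t ht => ?_)
    simpa using hk_gt_one t ht
  have hk_bot : k =O[nhdsWithin 0 (Set.Ioi 0)] fun t : ℝ => t ^ (-(0 : ℝ)) := by
    refine .of_bound M (Filter.eventually_of_mem (Ioc_mem_nhdsGT one_pos) fun t ht => ?_)
    simpa using hk_le_one t ht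
  have hmellin : ∀ z : ℝ, 0 < z → mellin g (z + b) = mellin k (z + b) + a * (1 / z) := by
    intro z hz
    have hk_conv : MellinConvergent k (z + b) :=
      mellinConvergent_of_isBigO_rpow_exp hc hk_loc hk_top hk_bot
        (by simpa using add_pos hz hb)
    have hp_mellin : HasMellin p (z + b) (1 / (z + b + -(b : ℂ))) :=
      hasMellin_cpow_Ioc _ (by simpa using hz)
    have hap := hasMellin_const_smul hp_mellin.1 a
    have hsum := (hasMellin_add hk_conv hap.1).2
    rw [hap.2, hp_mellin.2, add_neg_cancel_right] at hsum
    simpa [hk] using hsum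
  have hk_cont : Filter.Tendsto (fun z : ℝ => mellin k (z + b))
      (nhdsWithin 0 (Set.Ioi 0)) (nhds (mellin k b)) := by
    have hcont := (mellin_differentiableAt_of_isBigO_rpow_exp (s := (b : ℂ)) hc hk_loc hk_top
      hk_bot (by simpa using hb)).continuousAt
    refine hcont.tendsto.comp (tendsto_nhdsWithin_of_tendsto_nhds ?_)
    exact Continuous.tendsto' (by fun_prop) _ _ (by simp)
  have hz : Filter.Tendsto (fun z : ℝ => (z : ℂ)) (nhdsWithin 0 (Set.Ioi 0)) (nhds 0) :=
    tendsto_nhdsWithin_of_tendsto_nhds (Complex.continuous_ofReal.tendsto' _ _ (by simp))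
  have hlim := (hz.mul hk_cont).add_const a
  rw [zero_mul, zero_add] at hlim
  refine hlim.congr' (Filter.eventually_of_mem self_mem_nhdsWithin fun z hz_pos => ?_)
  have hz_ne : (z : ℂ) ≠ 0 := Complex.ofReal_ne_zero.2 (ne_of_gt hz_pos)
  simp only [hmellin z hz_pos]
  field_simp

theorem tendsto_sqrt_mul_of_eq_rpow_add_bounded {g h : ℝ → ℂ} {a : ℂ} {M : ℝ}
    (hbd : ∀ t ∈ Set.Ioc (0 : ℝ) 1, ‖h t‖ ≤ M)
    (hgh : ∀ t ∈ Set.Ioc (0 : ℝ) 1, g t = a * ((t ^ (-(1 / 2) : ℝ) : ℝ) : ℂ) + h t) :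
    Filter.Tendsto (fun ε : ℝ => ((Real.sqrt ε : ℝ) : ℂ) * g ε)
      (nhdsWithin (0 : ℝ) (Set.Ioi 0)) (nhds a) := by
  have hsqrt : Filter.Tendsto (fun ε : ℝ => ((Real.sqrt ε : ℝ) : ℂ))
      (nhdsWithin 0 (Set.Ioi 0)) (nhds 0) :=
    tendsto_nhdsWithin_of_tendsto_nhds
      (Continuous.tendsto' (by fun_prop) _ _ (by simp))
  have hsmall : Filter.Tendsto (fun ε : ℝ => ((Real.sqrt ε : ℝ) : ℂ) * h ε)
      (nhdsWithin 0 (Set.Ioi 0)) (nhds 0) :=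
    hsqrt.zero_mul_isBoundedUnder_le (Filter.isBoundedUnder_of_eventually_le
      (Filter.eventually_of_mem (Ioc_mem_nhdsGT one_pos) hbd))
  have hlim := hsmall.const_add a
  rw [add_zero] at hlim
  refine hlim.congr' (Filter.eventually_of_mem (Ioc_mem_nhdsGT one_pos) fun t ht => ?_)
  have hne : ((Real.sqrt t : ℝ) : ℂ) ≠ 0 :=
    Complex.ofReal_ne_zero.2 (Real.sqrt_pos.2 ht.1).ne'
  simp only [hgh t ht, Real.rpow_neg ht.1.le, ← Real.sqrt_eq_rpow, Complex.ofReal_inv]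
  field_simp

/-- Let `g : ℝ → ℂ` be measurable with `g(t) = a·t^{−1/2} + h(t)` on `(0,1]` for a bounded `h`,
and `‖g(t)‖ ≤ C·e^{−ct}` for `t ≥ 1`.  Then `√ε·g(ε) → a` as `ε → 0⁺`, and
`z·Γ(z+1/2)⁻¹·mellin g (z+1/2) → a/√π` as real `z → 0⁺`; in particular
`lim_{ε→0⁺} √ε·g(ε) = √π · lim_{z→0⁺} z·Γ(z+1/2)⁻¹·mellin g (z+1/2)`. -/
theorem finite_part_sqrt_eq_sqrt_pi_mul_residue_mellin
    (g : ℝ → ℂ) (hg : Measurable g) (a : ℂ)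
    (h : ℝ → ℂ) (M : ℝ)
    (hbd : ∀ t ∈ Set.Ioc (0 : ℝ) 1, ‖h t‖ ≤ M)
    (hgh : ∀ t ∈ Set.Ioc (0 : ℝ) 1,
      g t = a * ((t ^ (-(1 / 2) : ℝ) : ℝ) : ℂ) + h t)
    (C c : ℝ) (hC : 0 < C) (hc : 0 < c)
    (hdecay : ∀ t : ℝ, 1 ≤ t → ‖g t‖ ≤ C * Real.exp (-c * t)) :
    Filter.Tendsto (fun ε : ℝ => ((Real.sqrt ε : ℝ) : ℂ) * g ε)
        (nhdsWithin (0 : ℝ) (Set.Ioi 0)) (nhds a) ∧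
    Filter.Tendsto
        (fun z : ℝ => (z : ℂ) * (Complex.Gamma ((z : ℂ) + 1 / 2))⁻¹
          * mellin g ((z : ℂ) + 1 / 2))
        (nhdsWithin (0 : ℝ) (Set.Ioi 0))
        (nhds (a / ((Real.sqrt Real.pi : ℝ) : ℂ))) := by
  refine ⟨tendsto_sqrt_mul_of_eq_rpow_add_bounded hbd hgh, ?_⟩
  have hmellin := tendsto_mul_mellin_add_of_exp_decay hg (a := a) (b := 1 / 2) one_half_pos
    (M := M) (fun t ht => by simpa [hgh t ht] using hbd t ht) hc hdecay
  have hhalf : Complex.Gamma (1 / 2) = ((Real.sqrt Real.pi : ℝ) : ℂ) := by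
    rw [← Real.Gamma_one_half_eq, ← Complex.Gamma_ofReal]
    norm_num
  have hGamma : Filter.Tendsto (fun z : ℝ => (Complex.Gamma ((z : ℂ) + 1 / 2))⁻¹)
      (nhdsWithin 0 (Set.Ioi 0)) (nhds ((Real.sqrt Real.pi : ℝ) : ℂ)⁻¹) := by
    rw [← hhalf]
    refine (Complex.differentiable_one_div_Gamma.continuous.tendsto (1 / 2)).comp
      (tendsto_nhdsWithin_of_tendsto_nhds ?_)
    exact Continuous.tendsto' (by fun_prop) _ _ (by simp)
  refine (hmellin.mul hGamma).congr fun z => ?_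
  push_cast
  ring
end

section
/- Let m, N ∈ ℕ with m ≤ N, let f : ℝ → ℂ be measurable, let a₀, …, a_N ∈ ℂ, and let h : ℝ → ℂ be bounded on (0,1] with h(t) → 0 as t → 0⁺, such that f(t) = Σ_{j=0}^{N} a_j·t^{j−m} + h(t) for all t ∈ (0,1], and assume there exist C > 0, c > 0 with ‖f(t)‖ ≤ C·e^{−c t} for all t ≥ 1. Define G : ℂ → ℂ by G(z) = Σ_{j=0}^{N} a_j/(z + j − m) + ∫_{(0,1]} t^{z−1}·h(t) dt + ∫_{(1,∞)} t^{z−1}·f(t) dt. Then: (i) G(z) = mellin f z for every z with Re z > m; (ii) G(z)/Γ(z) → a_m as real z → 0⁺; and (iii) f(t) − Σ_{j=0}^{m−1} a_j·t^{j−m} → a_m as t → 0⁺. In particular the finite part of f at ε = 0 equals the value at z = 0 of the meromorphic continuation of the Gamma-normalized Mellin transform 𝓜(f)(z) = mellin f z / Γ(z). -/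
open Filter MeasureTheory Set Topology

theorem Complex.integrableOn_Ioc_cpow {s : ℂ} (hs : -1 < s.re) :
    IntegrableOn (fun t : ℝ => (t : ℂ) ^ s) (Ioc 0 1) :=
  (intervalIntegrable_iff_integrableOn_Ioc_of_le zero_le_one).1
    (intervalIntegral.intervalIntegrable_cpow' hs)

theorem Complex.integral_Ioc_cpow {s : ℂ} (hs : -1 < s.re) :
    ∫ t in Ioc (0 : ℝ) 1, (t : ℂ) ^ s = 1 / (s + 1) := by
  have hne : s + 1 ≠ 0 := by
    intro h0
    have := congrArg Complex.re h0
    simp at this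
    linarith
  rw [← intervalIntegral.integral_of_le zero_le_one, integral_cpow (Or.inl hs)]
  simp [Complex.zero_cpow hne]

theorem Real.integrableOn_Ioc_rpow {s : ℝ} (hs : -1 < s) :
    IntegrableOn (fun t : ℝ => t ^ s) (Ioc 0 1) :=
  (intervalIntegrable_iff_integrableOn_Ioc_of_le zero_le_one).1
    (intervalIntegral.intervalIntegrable_rpow' hs)

theorem Real.integral_Ioc_rpow {s : ℝ} (hs : -1 < s) :
    ∫ t in Ioc (0 : ℝ) 1, t ^ s = 1 / (s + 1) := by
  rw [← intervalIntegral.integral_of_le zero_le_one, integral_rpow (Or.inl hs)]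
  simp [Real.zero_rpow (by linarith : s + 1 ≠ 0)]

theorem Complex.measurable_ofReal_cpow_const (s : ℂ) :
    Measurable (fun t : ℝ => (t : ℂ) ^ s) :=
  Complex.measurable_ofReal.pow_const s

/-- The product of the Mellin variable with the Mellin integral over `(0, 1]` of a bounded function
vanishing at `0` tends to `0`. -/
theorem tendsto_mul_integral_Ioc_cpow_zero {h : ℝ → ℂ} {M : ℝ}
    (hbd : ∀ t ∈ Ioc (0 : ℝ) 1, ‖h t‖ ≤ M) (hh0 : Tendsto h (𝓝[>] 0) (𝓝 0)) :
    Tendsto (fun z : ℝ => (z : ℂ) * ∫ t in Ioc (0 : ℝ) 1, (t : ℂ) ^ ((z : ℂ) - 1) * h t)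
      (𝓝[>] 0) (𝓝 0) := by
  have hM : 0 ≤ M := (norm_nonneg _).trans (hbd 1 (by simp))
  rw [Metric.tendsto_nhds]
  intro ε hε
  obtain ⟨δ, hδ, hδh⟩ := (Metric.tendsto_nhdsWithin_nhds.1 hh0) (ε / 2) (half_pos hε)
  have hbound : ∀ t ∈ Ioc (0 : ℝ) 1, ‖h t‖ ≤ ε / 2 + M / δ * t := by
    intro t ht
    rcases lt_or_ge t δ with htδ | htδ
    · have h1 := hδh (x := t) ht.1 (by simpa [abs_of_pos ht.1] using htδ)
      rw [dist_zero_right] at h1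
      have : 0 ≤ M / δ * t := mul_nonneg (div_nonneg hM hδ.le) ht.1.le
      linarith
    · have h1 : M ≤ M / δ * t := by
        rw [div_mul_eq_mul_div, le_div_iff₀ hδ]
        exact mul_le_mul_of_nonneg_left htδ hM
      linarith [hbd t ht]
  have key : ∀ z : ℝ, 0 < z →
      ‖(z : ℂ) * ∫ t in Ioc (0 : ℝ) 1, (t : ℂ) ^ ((z : ℂ) - 1) * h t‖ ≤ ε / 2 + M / δ * z := by
    intro z hz
    have i1 := (Real.integrableOn_Ioc_rpow (by linarith : -1 < z - 1)).const_mul (ε / 2)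
    have i2 := (Real.integrableOn_Ioc_rpow (by linarith : -1 < z)).const_mul (M / δ)
    have hle : ‖∫ t in Ioc (0 : ℝ) 1, (t : ℂ) ^ ((z : ℂ) - 1) * h t‖ ≤
        ∫ t in Ioc (0 : ℝ) 1, (ε / 2 * t ^ (z - 1) + M / δ * t ^ z) := by
      refine norm_integral_le_of_norm_le (i1.add i2) ?_
      refine (ae_restrict_iff' measurableSet_Ioc).2 (Eventually.of_forall fun t ht => ?_)
      rw [norm_mul, Complex.norm_cpow_eq_rpow_re_of_pos ht.1]
      have e : t ^ z = t ^ (z - 1) * t := by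
        rw [← Real.rpow_add_one ht.1.ne', sub_add_cancel]
      calc t ^ ((z : ℂ) - 1).re * ‖h t‖ ≤ t ^ (z - 1) * (ε / 2 + M / δ * t) := by
            simpa using mul_le_mul_of_nonneg_left (hbound t ht) (Real.rpow_nonneg ht.1.le (z - 1))
        _ = _ := by rw [e]; ring
    rw [integral_add i1 i2, integral_const_mul, integral_const_mul,
      Real.integral_Ioc_rpow (by linarith), Real.integral_Ioc_rpow (by linarith)] at hle
    rw [norm_mul, Complex.norm_real, Real.norm_of_nonneg hz.le]
    refine (mul_le_mul_of_nonneg_left hle hz.le).trans ?_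
    have h1 : z * (ε / 2 * (1 / (z - 1 + 1)) + M / δ * (1 / (z + 1))) =
        ε / 2 + M / δ * (z / (z + 1)) := by
      rw [sub_add_cancel]
      field_simp
    rw [h1]
    gcongr
    exact div_le_self hz.le (by linarith)
  have hlim : Tendsto (fun z : ℝ => ε / 2 + M / δ * z) (𝓝[>] 0) (𝓝 (ε / 2)) := by
    have : Continuous fun z : ℝ => ε / 2 + M / δ * z := by fun_prop
    simpa using (this.tendsto 0).mono_left nhdsWithin_le_nhds
  filter_upwards [hlim.eventually_lt_const (half_lt_self hε), self_mem_nhdsWithin] with z hz hz0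
  rw [dist_zero_right]
  exact (key z hz0).trans_lt hz

/-- The product of the Mellin variable with the Mellin integral over `(1, ∞)` of an exponentially
decaying function tends to `0`. -/
theorem tendsto_mul_integral_Ioi_cpow_zero {f : ℝ → ℂ} {C c : ℝ} (hc : 0 < c)
    (hdecay : ∀ t : ℝ, 1 ≤ t → ‖f t‖ ≤ C * Real.exp (-c * t)) :
    Tendsto (fun z : ℝ => (z : ℂ) * ∫ t in Ioi (1 : ℝ), (t : ℂ) ^ ((z : ℂ) - 1) * f t)
      (𝓝[>] 0) (𝓝 0) := by
  set K := ∫ t in Ioi (1 : ℝ), C * Real.exp (-c * t)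
  have hint : IntegrableOn (fun t : ℝ => C * Real.exp (-c * t)) (Ioi 1) :=
    (exp_neg_integrableOn_Ioi 1 hc).const_mul C
  have hlim : Tendsto (fun z : ℝ => z * K) (𝓝[>] 0) (𝓝 0) := by
    have : Continuous fun z : ℝ => z * K := by fun_prop
    simpa using (this.tendsto 0).mono_left nhdsWithin_le_nhds
  refine squeeze_zero_norm' ?_ hlim
  filter_upwards [Ioc_mem_nhdsGT (zero_lt_one (α := ℝ))] with z hz
  rw [norm_mul, Complex.norm_real, Real.norm_of_nonneg hz.1.le]
  refine mul_le_mul_of_nonneg_left (norm_integral_le_of_norm_le hint ?_) hz.1.le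
  refine (ae_restrict_iff' measurableSet_Ioi).2 (Eventually.of_forall fun t ht => ?_)
  have ht1 : (1 : ℝ) < t := ht
  rw [norm_mul, Complex.norm_cpow_eq_rpow_re_of_pos (by linarith)]
  have h1 : t ^ ((z : ℂ) - 1).re ≤ 1 :=
    Real.rpow_le_one_of_one_le_of_nonpos ht1.le (by simpa using hz.2)
  exact (mul_le_of_le_one_left (norm_nonneg _) h1).trans (hdecay t ht1.le)

theorem integrableOn_Ioi_cpow_mul_of_exp_decay {f : ℝ → ℂ} (hf : Measurable f) {C c : ℝ}
    (hc : 0 < c) (hdecay : ∀ t : ℝ, 1 ≤ t → ‖f t‖ ≤ C * Real.exp (-c * t))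
    {z : ℂ} (hz : 0 < z.re) :
    IntegrableOn (fun t : ℝ => (t : ℂ) ^ (z - 1) * f t) (Ioi 1) := by
  have hi : IntegrableOn (fun t : ℝ => C * (t ^ (z.re - 1) * Real.exp (-c * t ^ (1 : ℝ)))) (Ioi 1) :=
    ((integrableOn_rpow_mul_exp_neg_mul_rpow (by linarith) one_pos hc).mono_set
      (Ioi_subset_Ioi zero_le_one)).const_mul C
  refine Integrable.mono' hi
    ((Complex.measurable_ofReal_cpow_const _).mul hf).aestronglyMeasurable ?_
  refine (ae_restrict_iff' measurableSet_Ioi).2 (Eventually.of_forall fun t ht => ?_)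
  have ht1 : (1 : ℝ) < t := ht
  rw [norm_mul, Complex.norm_cpow_eq_rpow_re_of_pos (by linarith), Real.rpow_one]
  calc t ^ (z - 1).re * ‖f t‖ ≤ t ^ (z.re - 1) * (C * Real.exp (-c * t)) := by
        simpa using mul_le_mul_of_nonneg_left (hdecay t ht1.le)
          (Real.rpow_nonneg (by linarith : 0 ≤ t) (z.re - 1))
    _ = _ := by ring

theorem tendsto_mul_sum_div_add_sub (m N : ℕ) (hmN : m ≤ N) (a : ℕ → ℂ) :
    Tendsto (fun z : ℝ => (z : ℂ) * ∑ j ∈ Finset.range (N + 1), a j / ((z : ℂ) + (j : ℂ) - (m : ℂ)))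
      (𝓝[>] 0) (𝓝 (a m)) := by
  have hsum : a m = ∑ j ∈ Finset.range (N + 1), if j = m then a j else 0 := by
    rw [Finset.sum_ite_eq', if_pos (Finset.mem_range.2 (by omega))]
  rw [hsum]
  simp_rw [Finset.mul_sum]
  refine tendsto_finsetSum _ fun j _ => ?_
  split_ifs with hj
  · subst hj
    refine tendsto_const_nhds.congr' ?_
    filter_upwards [self_mem_nhdsWithin] with z hz
    have hz0 : (z : ℂ) ≠ 0 := Complex.ofReal_ne_zero.2 (ne_of_gt hz)
    rw [add_sub_cancel_right]
    field_simp
  · have hne : ((0 : ℝ) : ℂ) + (j : ℂ) - (m : ℂ) ≠ 0 := by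
      rw [Complex.ofReal_zero, zero_add, sub_ne_zero]
      exact_mod_cast hj
    have hcont : ContinuousAt (fun z : ℝ => (z : ℂ) * (a j / ((z : ℂ) + (j : ℂ) - (m : ℂ)))) 0 := by
      refine Complex.continuous_ofReal.continuousAt.mul (continuousAt_const.div ?_ hne)
      fun_prop
    simpa using hcont.tendsto.mono_left nhdsWithin_le_nhds


/-- Mellin-transform lemma (BGV Lemma 9.35 form).  Let `f` be measurable with
`f(t) = Σ_{j=0}^{N} a_j t^{j−m} + h(t)` on `(0,1]` for `h` bounded with `h(t) → 0` as `t → 0⁺`,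
and with exponential decay at infinity.  With
`G(z) = Σ_j a_j/(z+j−m) + ∫_{(0,1]} t^{z−1} h(t) dt + ∫_{(1,∞)} t^{z−1} f(t) dt`, one has:
(i) `G(z) = mellin f z` for `Re z > m`;
(ii) `G(z)/Γ(z) → a_m` as real `z → 0⁺`;
(iii) `f(t) − Σ_{j<m} a_j t^{j−m} → a_m` as `t → 0⁺`.
In particular the finite part of `f` at `0` equals the value at `z = 0` of the meromorphic
continuation of the Gamma-normalized Mellin transform `𝓜(f)(z) = mellin f z / Γ(z)`. -/
theorem mellin_meromorphic_continuation_finite_part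
    (m N : ℕ) (hmN : m ≤ N) (f : ℝ → ℂ) (hf : Measurable f)
    (a : ℕ → ℂ) (h : ℝ → ℂ) (M : ℝ)
    (hbd : ∀ t ∈ Set.Ioc (0 : ℝ) 1, ‖h t‖ ≤ M)
    (hh0 : Filter.Tendsto h (nhdsWithin (0 : ℝ) (Set.Ioi 0)) (nhds 0))
    (hexp : ∀ t ∈ Set.Ioc (0 : ℝ) 1,
      f t = (∑ j ∈ Finset.range (N + 1),
          a j * ((t ^ ((j : ℝ) - (m : ℝ)) : ℝ) : ℂ)) + h t)
    (C c : ℝ) (hC : 0 < C) (hc : 0 < c)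
    (hdecay : ∀ t : ℝ, 1 ≤ t → ‖f t‖ ≤ C * Real.exp (-c * t))
    (G : ℂ → ℂ)
    (hG : ∀ z : ℂ,
      G z = (∑ j ∈ Finset.range (N + 1), a j / (z + (j : ℂ) - (m : ℂ)))
        + (∫ t in Set.Ioc (0 : ℝ) 1, (t : ℂ) ^ (z - 1) * h t)
        + ∫ t in Set.Ioi (1 : ℝ), (t : ℂ) ^ (z - 1) * f t) :
    (∀ z : ℂ, (m : ℝ) < z.re → G z = mellin f z) ∧
    Filter.Tendsto (fun z : ℝ => G (z : ℂ) / Complex.Gamma (z : ℂ))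
        (nhdsWithin (0 : ℝ) (Set.Ioi 0)) (nhds (a m)) ∧
    Filter.Tendsto
        (fun t : ℝ => f t - ∑ j ∈ Finset.range m,
          a j * ((t ^ ((j : ℝ) - (m : ℝ)) : ℝ) : ℂ))
        (nhdsWithin (0 : ℝ) (Set.Ioi 0)) (nhds (a m)) := by
  refine ⟨fun z hz => ?_, ?_, ?_⟩
  · have hz0 : 0 < z.re := (Nat.cast_nonneg m).trans_lt hz
    have hre : ∀ j : ℕ, -1 < (z - 1 + ((j : ℂ) - (m : ℂ))).re := by
      intro j
      have : (0 : ℝ) ≤ j := Nat.cast_nonneg j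
      simp
      linarith
    have hmeas : AEStronglyMeasurable (fun t : ℝ => (t : ℂ) ^ (z - 1) * h t)
        (volume.restrict (Ioc 0 1)) := by
      have hm : Measurable fun t : ℝ => (t : ℂ) ^ (z - 1) *
          (f t - ∑ j ∈ Finset.range (N + 1), a j * ((t ^ ((j : ℝ) - (m : ℝ)) : ℝ) : ℂ)) :=
        (Complex.measurable_ofReal_cpow_const _).mul (hf.sub (by fun_prop))
      refine hm.aestronglyMeasurable.congr ?_
      refine (ae_restrict_iff' measurableSet_Ioc).2 (Eventually.of_forall fun t ht => ?_)
      simp [hexp t ht]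
    have hinth : IntegrableOn (fun t : ℝ => (t : ℂ) ^ (z - 1) * h t) (Ioc 0 1) := by
      refine Integrable.mono'
        ((Real.integrableOn_Ioc_rpow (by linarith : -1 < z.re - 1)).mul_const M) hmeas ?_
      refine (ae_restrict_iff' measurableSet_Ioc).2 (Eventually.of_forall fun t ht => ?_)
      rw [norm_mul, Complex.norm_cpow_eq_rpow_re_of_pos ht.1]
      simpa using mul_le_mul_of_nonneg_left (hbd t ht) (Real.rpow_nonneg ht.1.le (z.re - 1))
    have hints : ∀ j ∈ Finset.range (N + 1), IntegrableOn
        (fun t : ℝ => a j * (t : ℂ) ^ (z - 1 + ((j : ℂ) - (m : ℂ)))) (Ioc 0 1) :=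
      fun j _ => (Complex.integrableOn_Ioc_cpow (hre j)).const_mul (a j)
    have heq : EqOn (fun t : ℝ => (t : ℂ) ^ (z - 1) * f t)
        (fun t : ℝ => (∑ j ∈ Finset.range (N + 1),
          a j * (t : ℂ) ^ (z - 1 + ((j : ℂ) - (m : ℂ)))) + (t : ℂ) ^ (z - 1) * h t) (Ioc 0 1) := by
      intro t ht
      have ht0 : (t : ℂ) ≠ 0 := Complex.ofReal_ne_zero.2 ht.1.ne'
      simp only [hexp t ht, mul_add, Finset.mul_sum]
      congr 1
      refine Finset.sum_congr rfl fun j _ => ?_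
      rw [Complex.cpow_add _ _ ht0, Complex.ofReal_cpow ht.1.le]
      push_cast
      ring
    have hintsum := integrable_finsetSum (Finset.range (N + 1)) hints
    have hintf : IntegrableOn (fun t : ℝ => (t : ℂ) ^ (z - 1) * f t) (Ioc 0 1) :=
      IntegrableOn.congr_fun (hintsum.add hinth) heq.symm measurableSet_Ioc
    have hintf' := integrableOn_Ioi_cpow_mul_of_exp_decay hf hc hdecay hz0
    rw [hG, mellin]
    simp_rw [smul_eq_mul]
    rw [← Ioc_union_Ioi_eq_Ioi (zero_le_one (α := ℝ)),
      setIntegral_union (Ioc_disjoint_Ioi le_rfl) measurableSet_Ioi hintf hintf',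
      setIntegral_congr_fun measurableSet_Ioc heq, integral_add hintsum hinth,
      integral_finsetSum _ hints]
    congr 2
    refine Finset.sum_congr rfl fun j _ => ?_
    rw [integral_const_mul, Complex.integral_Ioc_cpow (hre j), mul_one_div]
    congr 1
    ring
  · have hnum : Tendsto (fun z : ℝ => (z : ℂ) * G z) (𝓝[>] 0) (𝓝 (a m)) := by
      simpa only [hG, mul_add, add_zero] using ((tendsto_mul_sum_div_add_sub m N hmN a).add
        (tendsto_mul_integral_Ioc_cpow_zero hbd hh0)).add
        (tendsto_mul_integral_Ioi_cpow_zero hc hdecay)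
    have hden : Tendsto (fun z : ℝ => (z : ℂ) * Complex.Gamma z) (𝓝[>] 0) (𝓝 1) := by
      refine Complex.tendsto_self_mul_Gamma_nhds_zero.comp
        (tendsto_nhdsWithin_iff.2 ⟨?_, ?_⟩)
      · simpa using (Complex.continuous_ofReal.tendsto 0).mono_left nhdsWithin_le_nhds
      · filter_upwards [self_mem_nhdsWithin] with z hz
        exact Complex.ofReal_ne_zero.2 (ne_of_gt hz)
    have hdiv := hnum.div hden one_ne_zero
    rw [div_one] at hdiv
    refine hdiv.congr' ?_
    filter_upwards [self_mem_nhdsWithin] with z hz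
    exact mul_div_mul_left _ _ (Complex.ofReal_ne_zero.2 (ne_of_gt hz))
  · have hterm : ∀ j ∈ Finset.Ico m (N + 1), Tendsto
        (fun t : ℝ => a j * ((t ^ ((j : ℝ) - (m : ℝ)) : ℝ) : ℂ)) (𝓝[>] 0)
        (𝓝 (if j = m then a j else 0)) := by
      intro j hj
      have hmj : (m : ℝ) ≤ j := by exact_mod_cast (Finset.mem_Ico.1 hj).1
      have hcont : Continuous fun t : ℝ => a j * ((t ^ ((j : ℝ) - (m : ℝ)) : ℝ) : ℂ) :=
        continuous_const.mul (Complex.continuous_ofReal.comp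
          (Real.continuous_rpow_const (sub_nonneg.2 hmj)))
      convert (hcont.tendsto 0).mono_left nhdsWithin_le_nhds using 2
      split_ifs with hjm
      · simp [hjm]
      · have : (j : ℝ) - m ≠ 0 := sub_ne_zero.2 (by exact_mod_cast hjm)
        simp [Real.zero_rpow this]
    have hlim := (tendsto_finsetSum _ hterm).add hh0
    rw [Finset.sum_ite_eq', if_pos (Finset.mem_Ico.2 ⟨le_rfl, by omega⟩), add_zero] at hlim
    refine hlim.congr' ?_
    filter_upwards [Ioc_mem_nhdsGT (zero_lt_one (α := ℝ))] with t ht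
    rw [hexp t ht, ← Finset.sum_range_add_sum_Ico _ (by omega : m ≤ N + 1)]
    ring
end
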